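/- Let 0 ≤ β < 1 and σ > 0, and define λ₋⁰ := (1 − β²)(1 + 1/(2σ)) − √((1 − β²)²(1 − 1/(2σ))² + 4β²(1 − β²)/σ). Then: (i) λ₋⁰ equals (1 − β²)(1 + 1/(2σ)) − √((1 − β²)²(1 + 1/(2σ))² − (2(1 − β²)/σ)(1 − 3β²)); (ii) for λ₋(γ) := γ² + (1 − β²)(1 + 1/(2σ)) − √((1 − β²)²(1 − 1/(2σ))² + 4β²(γ² + (1 − β²)/σ)), one has λ₋(γ) → λ₋⁰ as γ → 0⁺; and (iii) λ₋⁰ < 0 if and only if β > 1/√3. -/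

import Mathlib

/-- The limiting eigenvalue `λ₋⁰` as the wavenumber tends to `0`. -/
noncomputable def lamMinusZero (β σ : ℝ) : ℝ :=
  (1 - β ^ 2) * (1 + 1 / (2 * σ)) -
    Real.sqrt ((1 - β ^ 2) ^ 2 * (1 - 1 / (2 * σ)) ^ 2 + 4 * β ^ 2 * (1 - β ^ 2) / σ)

/-- The eigenvalue `λ₋` at wavenumber `γ`. -/
noncomputable def lamMinus (β σ γ : ℝ) : ℝ :=
  γ ^ 2 + (1 - β ^ 2) * (1 + 1 / (2 * σ)) -
    Real.sqrt ((1 - β ^ 2) ^ 2 * (1 - 1 / (2 * σ)) ^ 2 +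
      4 * β ^ 2 * (γ ^ 2 + (1 - β ^ 2) / σ))

/-- Two equivalent forms of the discriminant under the square root in `λ₋⁰`. -/
theorem lamMinusZero_eq (β σ : ℝ) (hσ : σ ≠ 0) :
    lamMinusZero β σ =
      (1 - β ^ 2) * (1 + 1 / (2 * σ)) -
        Real.sqrt ((1 - β ^ 2) ^ 2 * (1 + 1 / (2 * σ)) ^ 2 -
          (2 * (1 - β ^ 2) / σ) * (1 - 3 * β ^ 2)) := by
  unfold lamMinusZero
  congr 2
  field_simp
  ring

theorem continuous_lamMinus (β σ : ℝ) : Continuous (lamMinus β σ) := by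
  unfold lamMinus
  fun_prop

theorem lamMinus_zero (β σ : ℝ) : lamMinus β σ 0 = lamMinusZero β σ := by
  simp [lamMinus, lamMinusZero, mul_div_assoc]

theorem one_div_sqrt_lt_iff {a x : ℝ} (ha : 0 < a) (hx : 0 ≤ x) :
    1 / Real.sqrt a < x ↔ 1 < a * x ^ 2 := by
  rw [div_lt_iff₀ (Real.sqrt_pos.mpr ha), ← one_lt_sq_iff₀ (by positivity), mul_pow,
    Real.sq_sqrt ha.le, mul_comm]

theorem lamMinusZero_neg_iff {β σ : ℝ} (hβ0 : 0 ≤ β) (hβ1 : β < 1) (hσ : 0 < σ) :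
    lamMinusZero β σ < 0 ↔ 1 / Real.sqrt 3 < β := by
  have hb : 0 < 1 - β ^ 2 := by nlinarith
  have hc : 0 < 2 * (1 - β ^ 2) / σ := by positivity
  have hp : 0 ≤ (1 - β ^ 2) * (1 + 1 / (2 * σ)) := by positivity
  rw [lamMinusZero_eq β σ hσ.ne', sub_neg, Real.lt_sqrt hp, mul_pow, lt_sub_comm,
    sub_self, ← smul_eq_mul, smul_neg_iff_of_pos_left hc, sub_neg,
    one_div_sqrt_lt_iff three_pos hβ0]

/-- (i) the alternative expression for `λ₋⁰`; (ii) `λ₋(γ) → λ₋⁰` as `γ → 0⁺`;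
(iii) `λ₋⁰ < 0` iff `β > 1/√3`. -/
theorem limiting_eigenvalue_properties (β σ : ℝ) (hβ0 : 0 ≤ β) (hβ1 : β < 1)
    (hσ : 0 < σ) :
    lamMinusZero β σ =
      (1 - β ^ 2) * (1 + 1 / (2 * σ)) -
        Real.sqrt ((1 - β ^ 2) ^ 2 * (1 + 1 / (2 * σ)) ^ 2 -
          (2 * (1 - β ^ 2) / σ) * (1 - 3 * β ^ 2)) ∧
    Filter.Tendsto (fun γ => lamMinus β σ γ) (nhdsWithin 0 (Set.Ioi 0))
      (nhds (lamMinusZero β σ)) ∧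
    (lamMinusZero β σ < 0 ↔ 1 / Real.sqrt 3 < β) := by
  refine ⟨lamMinusZero_eq β σ hσ.ne', ?_, lamMinusZero_neg_iff hβ0 hβ1 hσ⟩
  rw [← lamMinus_zero]
  exact (continuous_lamMinus β σ).continuousAt.mono_left nhdsWithin_le_nhds
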